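/- arXiv:1903.02833 — 2 statements merged into one kernel-verified Lean document; each statement's English description precedes it below -/
import Mathlib

section
/- In the mixed multi-factor rough Bergomi model, for every q > 1 and every t ∈ (0,1], the q-th moment of the integrated variance satisfies E[ ( (1/t)∫₀ᵗ v^{(γ,ν,Σ)}_s ds )^q ] ≤ (v₀^q·n^q / t^{q−1})·exp( (σ*²/2)·(q² − q)·t^β ), where σ*² := max_{1≤i≤n} νⁱ·(Σᵢ νⁱ) is the largest of the quadratic forms νⁱᵀ Σᵢ νⁱ. -/
open MeasureTheory ProbabilityTheory Set Matrix
open scoped ENNReal NNReal Matrix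

noncomputable section

/-- The time interval `[0,1]`. -/
abbrev I01 : Set ℝ := Set.Icc (0:ℝ) 1

/-- Jensen's inequality for `x ↦ x ^ q` under a probability measure, in `ℝ≥0∞`; no integrability
is needed since the left-hand side vanishes for a non-integrable function. -/
theorem ofReal_integral_rpow_le_lintegral {S : Type*} [MeasurableSpace S] (μ : Measure S)
    [IsProbabilityMeasure μ] {f : S → ℝ} (hf : Measurable f) (hf0 : 0 ≤ f) {q : ℝ} (hq : 1 ≤ q) :
    ENNReal.ofReal ((∫ s, f s ∂μ) ^ q) ≤ ∫⁻ s, ENNReal.ofReal (f s ^ q) ∂μ := by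
  have hq0 : 0 < q := by linarith
  have hmono := eLpNorm'_le_eLpNorm'_of_exponent_le (f := f) one_pos hq μ hf.aestronglyMeasurable
  have hint : ENNReal.ofReal (∫ s, f s ∂μ) ≤ eLpNorm' f 1 μ := by
    rw [integral_eq_lintegral_of_nonneg_ae (ae_of_all _ hf0) hf.aestronglyMeasurable]
    refine ENNReal.ofReal_toReal_le.trans (le_of_eq ?_)
    simp only [eLpNorm', ENNReal.rpow_one, div_one]
    exact lintegral_congr fun s => (Real.enorm_of_nonneg (hf0 s)).symm
  rw [← ENNReal.ofReal_rpow_of_nonneg (integral_nonneg hf0) hq0.le]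
  refine (ENNReal.rpow_le_rpow (hint.trans hmono) hq0.le).trans (le_of_eq ?_)
  rw [eLpNorm', ← ENNReal.rpow_mul, one_div_mul_cancel hq0.ne', ENNReal.rpow_one]
  refine lintegral_congr fun s => ?_
  rw [Real.enorm_of_nonneg (hf0 s), ENNReal.ofReal_rpow_of_nonneg (hf0 s) hq0.le]

/-- A bound on the `q`-th moments of the time marginals of a nonnegative process bounds the `q`-th
moment of its average over time. -/
theorem lintegral_rpow_integral_le {Ω S : Type*} [MeasurableSpace Ω] [MeasurableSpace S]
    (P : Measure Ω) [IsProbabilityMeasure P] (μ : Measure S) [IsProbabilityMeasure μ]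
    {F : Ω → S → ℝ} (hF : Measurable (Function.uncurry F)) (hF0 : ∀ ω s, 0 ≤ F ω s)
    {q : ℝ} (hq : 1 ≤ q) {C : ℝ≥0∞}
    (hC : ∀ᵐ s ∂μ, ∫⁻ ω, ENNReal.ofReal (F ω s ^ q) ∂P ≤ C) :
    ∫⁻ ω, ENNReal.ofReal ((∫ s, F ω s ∂μ) ^ q) ∂P ≤ C :=
  calc
    _ ≤ ∫⁻ ω, ∫⁻ s, ENNReal.ofReal (F ω s ^ q) ∂μ ∂P :=
      lintegral_mono fun ω =>
        ofReal_integral_rpow_le_lintegral μ (hF.comp measurable_prodMk_left) (hF0 ω) hq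
    _ = ∫⁻ s, ∫⁻ ω, ENNReal.ofReal (F ω s ^ q) ∂P ∂μ :=
      lintegral_lintegral_swap (hF.pow_const q).ennreal_ofReal.aemeasurable
    _ ≤ ∫⁻ _, C ∂μ := lintegral_mono_ae hC
    _ = C := by simp

/-- Moments of the normalised lognormal variable `exp (X - v / 2)`, `X` centred Gaussian of
variance `v`. -/
theorem lintegral_exp_sub_rpow_of_map_eq_gaussianReal {Ω : Type*} [MeasurableSpace Ω]
    {P : Measure Ω} {X : Ω → ℝ} (hX : Measurable X) {v : ℝ≥0}
    (hlaw : P.map X = gaussianReal 0 v) (q : ℝ) :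
    ∫⁻ ω, ENNReal.ofReal (Real.exp (X ω - v / 2) ^ q) ∂P =
      ENNReal.ofReal (Real.exp (v / 2 * (q ^ 2 - q))) := by
  have hint : Integrable (fun ω => Real.exp (q * X ω)) P := by
    have h := integrable_exp_mul_gaussianReal (μ := 0) (v := v) q
    rw [← hlaw] at h
    exact h.comp_measurable hX
  have hmgf : ∫ ω, Real.exp (q * X ω) ∂P = Real.exp (v * q ^ 2 / 2) := by
    simpa [mgf] using mgf_gaussianReal hlaw q
  have hsplit : ∀ ω, Real.exp (X ω - v / 2) ^ q =
      Real.exp (-(q * (v / 2))) * Real.exp (q * X ω) := fun ω => by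
    rw [← Real.exp_mul, ← Real.exp_add]
    ring_nf
  simp_rw [hsplit]
  rw [← ofReal_integral_eq_lintegral_ofReal (hint.const_mul _)
    (ae_of_all _ fun ω => by positivity), integral_const_mul, hmgf, ← Real.exp_add]
  ring_nf

/-- A convex combination of nonnegative variables with `q`-th moments at most `C` has `q`-th moment
at most `C`. -/
theorem lintegral_rpow_convex_combination_le {Ω ι : Type*} [MeasurableSpace Ω] [Fintype ι]
    (P : Measure Ω) {w : ι → ℝ} (hw : ∀ i, 0 ≤ w i) (hw1 : ∑ i, w i = 1)
    {X : ι → Ω → ℝ} (hX : ∀ i, Measurable (X i)) (hX0 : ∀ i ω, 0 ≤ X i ω)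
    {q : ℝ} (hq : 1 ≤ q) {C : ℝ≥0∞}
    (hC : ∀ i, ∫⁻ ω, ENNReal.ofReal (X i ω ^ q) ∂P ≤ C) :
    ∫⁻ ω, ENNReal.ofReal ((∑ i, w i * X i ω) ^ q) ∂P ≤ C :=
  calc
    _ ≤ ∫⁻ ω, ∑ i, ENNReal.ofReal (w i) * ENNReal.ofReal (X i ω ^ q) ∂P := by
      refine lintegral_mono fun ω => ?_
      refine (ENNReal.ofReal_le_ofReal (Real.rpow_arith_mean_le_arith_mean_rpow Finset.univ w
        (fun i => X i ω) (fun i _ => hw i) hw1 (fun i _ => hX0 i ω) hq)).trans (le_of_eq ?_)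
      rw [ENNReal.ofReal_sum_of_nonneg fun i _ =>
        mul_nonneg (hw i) (Real.rpow_nonneg (hX0 i ω) q)]
      exact Finset.sum_congr rfl fun i _ => ENNReal.ofReal_mul (hw i)
    _ = ∑ i, ENNReal.ofReal (w i) * ∫⁻ ω, ENNReal.ofReal (X i ω ^ q) ∂P := by
      rw [lintegral_finsetSum _ fun i _ =>
        ((hX i).pow_const q).ennreal_ofReal.const_mul _]
      exact Finset.sum_congr rfl fun i _ =>
        lintegral_const_mul _ ((hX i).pow_const q).ennreal_ofReal
    _ ≤ ∑ i, ENNReal.ofReal (w i) * C :=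
      Finset.sum_le_sum fun i _ => mul_le_mul_right (hC i) _
    _ = C := by
      rw [← Finset.sum_mul, ← ENNReal.ofReal_sum_of_nonneg fun i _ => hw i, hw1,
        ENNReal.ofReal_one, one_mul]

theorem dotProduct_mul_transpose_mulVec_self {m : ℕ} (A : Matrix (Fin m) (Fin m) ℝ)
    (x : Fin m → ℝ) : x ⬝ᵥ (A * Aᵀ) *ᵥ x = ∑ j, (x ᵥ* A) j ^ 2 := by
  rw [← mulVec_mulVec, dotProduct_mulVec, mulVec_transpose]
  simp [dotProduct, sq]

/-- Lemma 3.15: moment bound for the integrated variance in the mixed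
multi-factor rough Bergomi model. -/
theorem multifactor_rough_bergomi_moment_bound
    {Ω : Type*} [MeasurableSpace Ω] (P : Measure Ω) [IsProbabilityMeasure P]
    (α β η v0 : ℝ) (hα : α ∈ Set.Ioo (-(1:ℝ)/2) 0) (hβ : β = 2*α+1)
    (hη : 0 < η) (hv0 : 0 < v0)
    (m n : ℕ) (hm : 0 < m) (hn : 0 < n)
    (γ : Fin n → ℝ) (hγ : ∀ i, γ i ∈ Set.Icc (0:ℝ) 1) (hγsum : ∑ i, γ i = 1)
    (ν : Fin n → Fin m → ℝ)
    (L : Fin n → Matrix (Fin m) (Fin m) ℝ)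
    (hLtri : ∀ i, ∀ j k : Fin m, j < k → L i j k = 0)
    (hLpos : ∀ i, (L i * (L i)ᵀ).PosDef)
    (Z : Ω → ℝ → (Fin m → ℝ))
    (hZmeas : Measurable (Function.uncurry Z))
    (hZlaw : ∀ t ∈ I01, ∀ w : Fin m → ℝ,
      Measure.map (fun ω => ∑ j, w j * Z ω t j) P =
        gaussianReal 0 (Real.toNNReal ((∑ j, (w j)^2) * η^2 * t ^ β))) :
    ∀ q : ℝ, 1 < q → ∀ t ∈ Set.Ioc (0:ℝ) 1,
      ∫⁻ ω, ENNReal.ofReal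
          (((1/t) * ∫ s in Set.Icc 0 t,
            v0 * ∑ i, γ i * Real.exp ((1/η) * (ν i ⬝ᵥ (L i).mulVec (Z ω s)) -
              (1/2) * (ν i ⬝ᵥ (L i * (L i)ᵀ).mulVec (ν i)) * s ^ β)) ^ q) ∂P ≤
        ENNReal.ofReal ((v0 ^ q * (n:ℝ) ^ q / t ^ (q-1)) *
          Real.exp ((Finset.univ.sup' ⟨⟨0, hn⟩, Finset.mem_univ _⟩
              (fun i => ν i ⬝ᵥ (L i * (L i)ᵀ).mulVec (ν i))) / 2 *
            (q^2 - q) * t ^ β)) := by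
  intro q hq t ht
  obtain ⟨ht0, ht1⟩ := ht
  have hβ0 : 0 < β := by linarith [hα.1]
  set Q : Fin n → ℝ := fun i => ν i ⬝ᵥ (L i * (L i)ᵀ).mulVec (ν i) with hQ
  set σ : ℝ := Finset.univ.sup' ⟨⟨0, hn⟩, Finset.mem_univ _⟩ Q with hσ
  have hQsum : ∀ i, Q i = ∑ j, (ν i ᵥ* L i) j ^ 2 := fun i =>
    dotProduct_mul_transpose_mulVec_self (L i) (ν i)
  have hQ0 : ∀ i, 0 ≤ Q i := fun i => by rw [hQsum]; positivity
  have hQσ : ∀ i, Q i ≤ σ := fun i => Finset.le_sup' Q (Finset.mem_univ i)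
  have hqq : 0 ≤ q ^ 2 - q := by nlinarith
  set X : Fin n → Ω → ℝ → ℝ := fun i ω s =>
    Real.exp ((1/η) * (ν i ⬝ᵥ (L i).mulVec (Z ω s)) - (1/2) * Q i * s ^ β) with hX
  have hlin : ∀ i z, (1/η) * (ν i ⬝ᵥ (L i).mulVec z) =
      ∑ j, ((1/η) * (ν i ᵥ* L i) j) * z j := fun i z => by
    rw [dotProduct_mulVec, dotProduct, Finset.mul_sum]
    exact Finset.sum_congr rfl fun j _ => (mul_assoc _ _ _).symm
  have hXmeas : ∀ i, Measurable (Function.uncurry (X i)) := fun i => by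
    have hZj : ∀ j, Measurable fun p : Ω × ℝ => Z p.1 p.2 j := fun j =>
      (measurable_pi_apply j).comp hZmeas
    simp only [hX, hlin, Function.uncurry_def]
    fun_prop
  have hmoment : ∀ i, ∀ s ∈ Icc 0 t, ∫⁻ ω, ENNReal.ofReal (X i ω s ^ q) ∂P ≤
      ENNReal.ofReal (Real.exp (σ / 2 * (q ^ 2 - q) * t ^ β)) := fun i s hs => by
    have hsβ : 0 ≤ s ^ β := Real.rpow_nonneg hs.1 β
    have hvar : (∑ j, ((1/η) * (ν i ᵥ* L i) j) ^ 2) * η ^ 2 * s ^ β = Q i * s ^ β := by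
      simp only [mul_pow, ← Finset.mul_sum, hQsum]
      field_simp
    have hlaw := hZlaw s ⟨hs.1, hs.2.trans ht1⟩ fun j => (1/η) * (ν i ᵥ* L i) j
    rw [hvar] at hlaw
    have hZs : ∀ j, Measurable fun ω => Z ω s j := fun j =>
      (measurable_pi_apply j).comp (hZmeas.comp measurable_prodMk_right)
    have h := lintegral_exp_sub_rpow_of_map_eq_gaussianReal (by fun_prop) hlaw q
    rw [Real.coe_toNNReal _ (mul_nonneg (hQ0 i) hsβ)] at h
    have hXeq : ∀ ω, X i ω s =
        Real.exp (∑ j, ((1/η) * (ν i ᵥ* L i) j) * Z ω s j - Q i * s ^ β / 2) := fun ω => by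
      simp only [hX, hlin]
      ring_nf
    simp_rw [hXeq, h]
    refine ENNReal.ofReal_le_ofReal (Real.exp_le_exp.2 ?_)
    have hmul : Q i * s ^ β ≤ σ * t ^ β :=
      mul_le_mul (hQσ i) (Real.rpow_le_rpow hs.1 hs.2 hβ0.le) hsβ ((hQ0 i).trans (hQσ i))
    nlinarith
  set μ : Measure ℝ := ENNReal.ofReal (1/t) • volume.restrict (Icc 0 t) with hμ
  have : IsProbabilityMeasure μ := ⟨by
    rw [hμ, Measure.smul_apply, Measure.restrict_apply_univ, Real.volume_Icc, smul_eq_mul,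
      ← ENNReal.ofReal_mul (by positivity), sub_zero, one_div_mul_cancel ht0.ne',
      ENNReal.ofReal_one]⟩
  have hμint : ∀ f : ℝ → ℝ, (1/t) * ∫ s in Icc 0 t, f s = ∫ s, f s ∂μ := fun f => by
    rw [hμ, integral_smul_measure, ENNReal.toReal_ofReal (by positivity), smul_eq_mul]
  have hmix : ∫⁻ ω, ENNReal.ofReal ((∫ s, ∑ i, γ i * X i ω s ∂μ) ^ q) ∂P ≤
      ENNReal.ofReal (Real.exp (σ / 2 * (q ^ 2 - q) * t ^ β)) := by
    refine lintegral_rpow_integral_le P μ (F := fun ω s => ∑ i, γ i * X i ω s)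
      (Finset.measurable_sum _ fun i _ => (hXmeas i).const_mul (γ i))
      (fun ω s => Finset.sum_nonneg fun i _ => mul_nonneg (hγ i).1 (Real.exp_pos _).le) hq.le ?_
    refine Measure.ae_smul_measure (ae_restrict_of_forall_mem measurableSet_Icc fun s hs => ?_) _
    exact lintegral_rpow_convex_combination_le P (fun i => (hγ i).1) hγsum
      (fun i => (hXmeas i).comp measurable_prodMk_right) (fun i ω => (Real.exp_pos _).le) hq.le
      fun i => hmoment i s hs
  have hconst : v0 ^ q ≤ v0 ^ q * (n : ℝ) ^ q / t ^ (q - 1) := by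
    have hnq : 1 ≤ (n : ℝ) ^ q := Real.one_le_rpow (by exact_mod_cast hn) (by linarith)
    have htq : t ^ (q - 1) ≤ 1 := Real.rpow_le_one ht0.le ht1 (by linarith)
    rw [le_div_iff₀ (Real.rpow_pos_of_pos ht0 _)]
    exact mul_le_mul_of_nonneg_left (htq.trans hnq) (Real.rpow_nonneg hv0.le q)
  calc
    _ = ∫⁻ ω, ENNReal.ofReal (v0 ^ q) *
        ENNReal.ofReal ((∫ s, ∑ i, γ i * X i ω s ∂μ) ^ q) ∂P := by
      refine lintegral_congr fun ω => ?_
      rw [hμint, integral_const_mul, Real.mul_rpow hv0.le (integral_nonneg fun s =>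
        Finset.sum_nonneg fun i _ => mul_nonneg (hγ i).1 (Real.exp_pos _).le),
        ENNReal.ofReal_mul (Real.rpow_nonneg hv0.le q)]
    _ = ENNReal.ofReal (v0 ^ q) *
        ∫⁻ ω, ENNReal.ofReal ((∫ s, ∑ i, γ i * X i ω s ∂μ) ^ q) ∂P :=
      lintegral_const_mul' _ _ ENNReal.ofReal_ne_top
    _ ≤ ENNReal.ofReal (v0 ^ q) * ENNReal.ofReal (Real.exp (σ / 2 * (q ^ 2 - q) * t ^ β)) :=
      mul_le_mul_right hmix _
    _ ≤ _ := by
      rw [← ENNReal.ofReal_mul (Real.rpow_nonneg hv0.le q)]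
      exact ENNReal.ofReal_le_ofReal
        (mul_le_mul_of_nonneg_right hconst (Real.exp_pos _).le)

end
end

section
/- Fix T > 0, v₀ > 0 and real numbers α, a, b. On the open set U := { x > 0 : b + a·log(x/v₀) > 0 }, define the linear implied-volatility smile σ̂(x) := T^α·(b + a·log(x/v₀)), d₁(x) := (log v₀ − log x)/(σ̂(x)·√T) + σ̂(x)·√T/2, d₂(x) := d₁(x) − σ̂(x)·√T, and the Black–Scholes call price C(x) := v₀·Φ(d₁(x)) − x·Φ(d₂(x)), where Φ is the standard normal CDF and φ(z) := e^{−z²/2}/√(2π) the standard normal density. Then for every x ∈ U: (i) d₁ is differentiable at x with d₁'(x) = −b·T^α/(x·σ̂(x)²·√T) + a·T^{α+1/2}/(2x); (ii) C is differentiable at x with C'(x) = v₀·φ(d₁(x))·a·T^{α+1/2}/x − Φ(d₂(x)); (iii) C is twice differentiable at x with C''(x) = −φ(d₂(x))·d₁'(x)·( a·T^{α+1/2}·d₁(x) + 1 ). (By the Breeden–Litzenberger formula, C''(x) is the density ψ_RV(x,T) of realised variance at maturity T under the linear-smile assumption.) -/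
open MeasureTheory Set
open scoped ENNReal NNReal

noncomputable section

/-- Standard normal probability density function. -/
noncomputable def phi (z : ℝ) : ℝ := Real.exp (-(z^2)/2) / Real.sqrt (2*Real.pi)

/-- Standard normal cumulative distribution function. -/
noncomputable def Phi (z : ℝ) : ℝ := ∫ t in Set.Iic z, phi t

/-- Linear (in log-moneyness) implied volatility smile `σ̂(x) = T^α (b + a log(x/v₀))`. -/
noncomputable def sigmaHat (T v0 α a b x : ℝ) : ℝ := T ^ α * (b + a * Real.log (x / v0))

/-- Black–Scholes argument `d₁`. -/
noncomputable def d1 (T v0 α a b x : ℝ) : ℝ :=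
  (Real.log v0 - Real.log x) / (sigmaHat T v0 α a b x * Real.sqrt T) +
    sigmaHat T v0 α a b x * Real.sqrt T / 2

/-- Black–Scholes argument `d₂ = d₁ − σ̂√T`. -/
noncomputable def d2 (T v0 α a b x : ℝ) : ℝ :=
  d1 T v0 α a b x - sigmaHat T v0 α a b x * Real.sqrt T

/-- Black–Scholes call price with strike-dependent volatility `σ̂(x)`. -/
noncomputable def Cbs (T v0 α a b x : ℝ) : ℝ :=
  v0 * Phi (d1 T v0 α a b x) - x * Phi (d2 T v0 α a b x)

/-- The claimed first derivative of `d₁`. -/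
noncomputable def d1' (T v0 α a b x : ℝ) : ℝ :=
  -(b * T ^ α) / (x * (sigmaHat T v0 α a b x)^2 * Real.sqrt T) +
    a * T ^ (α + 1/2) / (2 * x)

/-- The claimed first derivative of the call price `C`. -/
noncomputable def Cbs' (T v0 α a b x : ℝ) : ℝ :=
  v0 * phi (d1 T v0 α a b x) * a * T ^ (α + 1/2) / x - Phi (d2 T v0 α a b x)

theorem continuous_phi : Continuous phi := by
  unfold phi
  fun_prop

theorem integrable_phi : Integrable phi := by
  have h := (integrable_exp_neg_mul_sq (b := 1 / 2) (by norm_num)).div_const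
    (Real.sqrt (2 * Real.pi))
  refine h.congr (Filter.Eventually.of_forall fun z => ?_)
  simp only [phi]
  congr 2
  ring

theorem hasDerivAt_phi (z : ℝ) : HasDerivAt phi (-z * phi z) z := by
  have h := ((((hasDerivAt_id z).pow 2).neg.div_const 2).exp).div_const (Real.sqrt (2 * Real.pi))
  refine h.congr_deriv ?_
  simp [phi]
  ring

theorem hasDerivAt_Phi (z : ℝ) : HasDerivAt Phi (phi z) z := by
  have h : Phi = fun y => Phi 0 + ∫ t in (0 : ℝ)..y, phi t := by
    funext y
    have := intervalIntegral.integral_Iic_sub_Iic (μ := volume) (a := 0) (b := y)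
      integrable_phi.integrableOn integrable_phi.integrableOn
    simp only [Phi]
    linarith
  rw [h]
  exact (continuous_phi.integral_hasStrictDerivAt 0 z).hasDerivAt.const_add _

theorem rpow_add_half {T : ℝ} (hT : 0 < T) (α : ℝ) :
    T ^ (α + 1 / 2) = T ^ α * Real.sqrt T := by
  rw [Real.rpow_add hT, Real.sqrt_eq_rpow]

theorem hasDerivAt_sigmaHat (T α a b : ℝ) {v0 x : ℝ} (hv0 : 0 < v0) (hx : 0 < x) :
    HasDerivAt (sigmaHat T v0 α a b) (T ^ α * a / x) x := by
  have h := (((((hasDerivAt_id x).div_const v0).log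
    (div_pos hx hv0).ne').const_mul a).const_add b).const_mul (T ^ α)
  refine h.congr_deriv ?_
  simp only [id]
  field_simp

theorem sigmaHat_pos {T v0 α a b x : ℝ} (hT : 0 < T) (hpos : 0 < b + a * Real.log (x / v0)) :
    0 < sigmaHat T v0 α a b x :=
  mul_pos (Real.rpow_pos_of_pos hT α) hpos

theorem hasDerivAt_d1 {T v0 α a b x : ℝ} (hT : 0 < T) (hv0 : 0 < v0) (hx : 0 < x)
    (hpos : 0 < b + a * Real.log (x / v0)) :
    HasDerivAt (d1 T v0 α a b) (d1' T v0 α a b x) x := by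
  have hσ := sigmaHat_pos (α := α) hT hpos
  have hs : 0 < Real.sqrt T := Real.sqrt_pos.mpr hT
  have hd := hasDerivAt_sigmaHat T α a b hv0 hx
  have h := (((Real.hasDerivAt_log hx.ne').const_sub (Real.log v0)).div
    (hd.mul_const (Real.sqrt T)) (mul_pos hσ hs).ne').add
    ((hd.mul_const (Real.sqrt T)).div_const 2)
  refine h.congr_deriv ?_
  have hb : b * T ^ α =
      sigmaHat T v0 α a b x + T ^ α * a * (Real.log v0 - Real.log x) := by
    rw [sigmaHat, Real.log_div hx.ne' hv0.ne']
    ring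
  rw [d1', rpow_add_half hT, hb]
  field_simp
  ring

theorem hasDerivAt_d2 {T v0 α a b x : ℝ} (hT : 0 < T) (hv0 : 0 < v0) (hx : 0 < x)
    (hpos : 0 < b + a * Real.log (x / v0)) :
    HasDerivAt (d2 T v0 α a b) (d1' T v0 α a b x - a * T ^ (α + 1 / 2) / x) x := by
  refine ((hasDerivAt_d1 hT hv0 hx hpos).sub
    ((hasDerivAt_sigmaHat T α a b hv0 hx).mul_const (Real.sqrt T))).congr_deriv ?_
  rw [rpow_add_half hT]
  ring

/-- The vega identity of the Black–Scholes formula. -/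
theorem mul_phi_d2_eq {T v0 α a b x : ℝ} (hT : 0 < T) (hv0 : 0 < v0) (hx : 0 < x)
    (hpos : 0 < b + a * Real.log (x / v0)) :
    x * phi (d2 T v0 α a b x) = v0 * phi (d1 T v0 α a b x) := by
  have hσ := sigmaHat_pos (α := α) hT hpos
  have hs : 0 < Real.sqrt T := Real.sqrt_pos.mpr hT
  have key : Real.log x + -(d2 T v0 α a b x ^ 2) / 2 =
      Real.log v0 + -(d1 T v0 α a b x ^ 2) / 2 := by
    rw [d2, d1]
    field_simp
    ring
  have := congrArg Real.exp key
  rw [Real.exp_add, Real.exp_add, Real.exp_log hx, Real.exp_log hv0] at this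
  rw [phi, phi, ← mul_div_assoc, ← mul_div_assoc, this]

/-- Proposition A.3: derivatives of the Black–Scholes call price under a
log-linear implied volatility smile; by Breeden–Litzenberger, `C''` is the realised-variance
density. -/
theorem linear_smile_call_derivatives
    (T v0 α a b : ℝ) (hT : 0 < T) (hv0 : 0 < v0) :
    ∀ x : ℝ, 0 < x → 0 < b + a * Real.log (x / v0) →
      HasDerivAt (fun y => d1 T v0 α a b y) (d1' T v0 α a b x) x ∧
      HasDerivAt (fun y => Cbs T v0 α a b y) (Cbs' T v0 α a b x) x ∧
      HasDerivAt (fun y => Cbs' T v0 α a b y)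
        (-(phi (d2 T v0 α a b x)) * d1' T v0 α a b x *
          (a * T ^ (α + 1/2) * d1 T v0 α a b x + 1)) x := by
  intro x hx hpos
  have h1 := hasDerivAt_d1 (α := α) hT hv0 hx hpos
  have h2 := hasDerivAt_d2 (α := α) hT hv0 hx hpos
  have hvega := mul_phi_d2_eq (α := α) hT hv0 hx hpos
  have hP2 := (hasDerivAt_Phi (d2 T v0 α a b x)).comp x h2
  refine ⟨h1, ?_, ?_⟩
  · refine ((((hasDerivAt_Phi (d1 T v0 α a b x)).comp x h1).const_mul v0).sub
      ((hasDerivAt_id x).mul hP2)).congr_deriv ?_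
    simp only [Cbs', id, Function.comp_apply]
    linear_combination (a * T ^ (α + 1 / 2) / x - d1' T v0 α a b x) * hvega
  · refine (((((((hasDerivAt_phi (d1 T v0 α a b x)).comp x h1).const_mul v0).mul_const
      a).mul_const (T ^ (α + 1 / 2))).div (hasDerivAt_id x) hx.ne').sub hP2).congr_deriv ?_
    have hphi : phi (d2 T v0 α a b x) = v0 * phi (d1 T v0 α a b x) / x := by
      rw [eq_div_iff hx.ne', mul_comm, hvega]
    simp only [id, Function.comp_apply]
    rw [hphi]
    field_simp
    ring

end
end
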